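/- arXiv:2501.01088 — 6 statements merged into one kernel-verified Lean document; each statement's English description precedes it below -/
import Mathlib

section
/- (Schur–Weyl twirl over the unitary group.) Let d ≥ 2 and let A be any matrix indexed by Fin d × Fin d over ℂ. Then ∫ (U ⊗ₖ U) * A * (U ⊗ₖ U)ᴴ dμ_U(U) = a₁ • 1 + a₂ • S, where a₁ = (trace(A) − d⁻¹·trace(S*A))/(d² − 1) and a₂ = (trace(S*A) − d⁻¹·trace(A))/(d² − 1). -/
open Matrix MeasureTheory
open scoped Kronecker

attribute [local instance] Matrix.normedAddCommGroup Matrix.normedSpace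

/-- The swap operator `S` on `ℂ^(d·d)`: `S_{(i,j),(k,l)} = 1` iff `i = l` and `j = k`. -/
def swapOp (d : ℕ) : Matrix (Fin d × Fin d) (Fin d × Fin d) ℂ :=
  Matrix.of fun p q => if p.1 = q.2 ∧ p.2 = q.1 then 1 else 0

noncomputable instance (d : ℕ) : MeasurableSpace (Matrix.unitaryGroup (Fin d) ℂ) := borel _
instance (d : ℕ) : BorelSpace (Matrix.unitaryGroup (Fin d) ℂ) := ⟨rfl⟩

theorem swapOp_apply (d : ℕ) (i j k l : Fin d) :
    swapOp d (i, j) (k, l) = if i = l ∧ j = k then 1 else 0 := rfl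

theorem kronecker_self_mul_swapOp {d : ℕ} (V : Matrix (Fin d) (Fin d) ℂ) :
    (V ⊗ₖ V) * swapOp d = swapOp d * (V ⊗ₖ V) := by
  ext ⟨i, j⟩ ⟨k, l⟩
  simp [Matrix.mul_apply, Fintype.sum_prod_type, swapOp_apply, kroneckerMap_apply, ite_and,
    mul_comm]

theorem swapOp_mul_swapOp (d : ℕ) : swapOp d * swapOp d = 1 := by
  ext ⟨i, j⟩ ⟨k, l⟩
  simp [Matrix.mul_apply, Fintype.sum_prod_type, swapOp_apply, ite_and, Matrix.one_apply]

theorem trace_swapOp (d : ℕ) : Matrix.trace (swapOp d) = d := by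
  simp [Matrix.trace, Fintype.sum_prod_type, swapOp_apply, eq_comm]

theorem permMatrix_mem_unitaryGroup {n : Type*} [Fintype n] [DecidableEq n]
    (σ : Equiv.Perm n) : σ.permMatrix ℂ ∈ Matrix.unitaryGroup n ℂ := by
  rw [Matrix.mem_unitaryGroup_iff, Matrix.star_eq_conjTranspose, Matrix.conjTranspose_permMatrix,
    ← Matrix.permMatrix_mul]
  simp

theorem diagonal_update_I_mem_unitaryGroup {n : Type*} [Fintype n] [DecidableEq n] (x : n) :
    Matrix.diagonal (fun i => if i = x then Complex.I else 1) ∈ Matrix.unitaryGroup n ℂ := by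
  rw [Matrix.mem_unitaryGroup_iff, Matrix.star_eq_conjTranspose, Matrix.diagonal_conjTranspose,
    Matrix.diagonal_mul_diagonal, ← Matrix.diagonal_one]
  congr 1
  ext i
  by_cases h : i = x <;> simp [h]

/-- The unitary acting as `I` on the all-ones vector and as the identity on its complement. -/
theorem one_add_const_mem_unitaryGroup {d : ℕ} (hd : d ≠ 0) :
    (1 + Matrix.of fun _ _ => (Complex.I - 1) / d : Matrix (Fin d) (Fin d) ℂ) ∈
      Matrix.unitaryGroup (Fin d) ℂ := by
  have hd' : (d : ℂ) ≠ 0 := by exact_mod_cast hd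
  rw [Matrix.mem_unitaryGroup_iff, Matrix.star_eq_conjTranspose, Matrix.conjTranspose_add,
    Matrix.conjTranspose_one, add_mul, one_mul, mul_add, mul_one, add_assoc]
  convert add_zero (1 : Matrix (Fin d) (Fin d) ℂ)
  ext i j
  simp [Matrix.mul_apply]
  field_simp
  ring_nf
  simp

/-- The commutant of `{V ⊗ₖ V | V unitary}` is spanned by `1` and the swap. -/
theorem exists_eq_smul_one_add_smul_swapOp {d : ℕ} (hd : 2 ≤ d)
    (M : Matrix (Fin d × Fin d) (Fin d × Fin d) ℂ)
    (hM : ∀ V ∈ Matrix.unitaryGroup (Fin d) ℂ, (V ⊗ₖ V) * M = M * (V ⊗ₖ V)) :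
    ∃ a b : ℂ, M = a • 1 + b • swapOp d := by
  have hdiag (x i j k l : Fin d) : (if i = x then Complex.I else 1) *
      (if j = x then Complex.I else 1) * M (i, j) (k, l) =
      M (i, j) (k, l) * ((if k = x then Complex.I else 1) * (if l = x then Complex.I else 1)) := by
    have h := congr_fun (congr_fun (hM _ (diagonal_update_I_mem_unitaryGroup x)) (i, j)) (k, l)
    rwa [Matrix.diagonal_kronecker_diagonal, Matrix.diagonal_mul, Matrix.mul_diagonal] at h
  have hperm (σ : Equiv.Perm (Fin d)) (i j k l : Fin d) :
      M (σ i, σ j) (σ k, σ l) = M (i, j) (k, l) := by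
    have h := congr_fun (congr_fun (hM _ (permMatrix_mem_unitaryGroup σ)) (i, j)) (σ k, σ l)
    simpa [Matrix.mul_apply, Fintype.sum_prod_type, kroneckerMap_apply, Equiv.Perm.permMatrix,
      PEquiv.toMatrix_apply, ite_and] using h
  have hsupp (i j k l : Fin d) (h₁ : ¬(i = k ∧ j = l)) (h₂ : ¬(i = l ∧ j = k)) :
      M (i, j) (k, l) = 0 := by
    by_contra h
    have hI : Complex.I ≠ 1 := by simp [Complex.ext_iff]
    have key (x : Fin d) : (if i = x then Complex.I else 1) * (if j = x then Complex.I else 1) =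
      (if k = x then Complex.I else 1) * (if l = x then Complex.I else 1) := by
      have := hdiag x i j k l
      rw [mul_comm (M _ _)] at this
      exact mul_right_cancel₀ h this
    have hI' : (-1 : ℂ) ≠ Complex.I := by simp [Complex.ext_iff]
    have h1 : (-1 : ℂ) ≠ 1 := by norm_num
    have hII := Complex.I_mul_I
    have ki := key i
    have kj := key j
    grind
  let z : Fin d := ⟨0, by omega⟩
  let o : Fin d := ⟨1, by omega⟩
  have hzo : z ≠ o := by simp [z, o]
  have hpair (i j : Fin d) (hij : i ≠ j) : ∃ σ : Equiv.Perm (Fin d), σ z = i ∧ σ o = j :=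
    (MulAction.is_two_pretransitive_iff (G := Equiv.Perm (Fin d))).1
      (Equiv.Perm.isMultiplyPretransitive (Fin d) 2) hzo hij
  set a := M (z, o) (z, o) with ha
  set b := M (z, o) (o, z) with hb
  have ha' (i j : Fin d) (hij : i ≠ j) : M (i, j) (i, j) = a := by
    obtain ⟨σ, rfl, rfl⟩ := hpair i j hij
    exact hperm σ ..
  have hb' (i j : Fin d) (hij : i ≠ j) : M (i, j) (j, i) = b := by
    obtain ⟨σ, rfl, rfl⟩ := hpair i j hij
    exact hperm σ ..
  set e := M (z, z) (z, z) - a - b with he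
  have he' (i : Fin d) : M (i, i) (i, i) = a + b + e := by
    have := hperm (Equiv.swap z i) z z z z
    rw [Equiv.swap_apply_left] at this
    rw [this, he]; ring
  have hMe : M = a • 1 + b • swapOp d +
      Matrix.diagonal (fun p : Fin d × Fin d => if p.1 = p.2 then e else 0) := by
    ext ⟨i, j⟩ ⟨k, l⟩
    by_cases h₁ : i = k ∧ j = l
    · obtain ⟨rfl, rfl⟩ := h₁
      by_cases hij : i = j
      · subst hij
        simp [swapOp_apply, he']
      · simp [swapOp_apply, ha' _ _ hij, hij]
    · by_cases h₂ : i = l ∧ j = k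
      · obtain ⟨rfl, rfl⟩ := h₂
        have hij : i ≠ j := by rintro rfl; simp at h₁
        simp [swapOp_apply, hb' _ _ hij, hij]
      · simp [hsupp _ _ _ _ h₁ h₂, swapOp_apply, h₁, h₂]
  have he0 : e = 0 := by
    have hV := hM _ (one_add_const_mem_unitaryGroup (d := d) (by omega))
    rw [hMe] at hV
    simp only [mul_add, add_mul, Matrix.mul_smul, Matrix.smul_mul, mul_one, one_mul,
      kronecker_self_mul_swapOp] at hV
    have hVd := add_left_cancel hV
    have h := congr_fun (congr_fun hVd (z, z)) (z, o)
    rw [Matrix.mul_diagonal, Matrix.diagonal_mul] at h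
    have hd' : (d : ℂ) ≠ 0 := by exact_mod_cast (by omega : d ≠ 0)
    have h1 : (Complex.I - 1) / d ≠ 0 := by
      refine div_ne_zero ?_ hd'
      simp [sub_eq_zero, Complex.ext_iff]
    have h2 : 1 + (Complex.I - 1) / d ≠ 0 := by
      intro h
      have : (d : ℂ) - 1 + Complex.I = 0 := by field_simp at h; linear_combination h
      have := congr_arg Complex.im this
      simp at this
    simpa [kroneckerMap_apply, hzo, h1, h2] using h
  refine ⟨a, b, ?_⟩
  rw [he0] at hMe
  simpa using hMe

theorem kronecker_self_mem_unitaryGroup {d : ℕ} (U : Matrix.unitaryGroup (Fin d) ℂ) :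
    ((U : Matrix (Fin d) (Fin d) ℂ) ⊗ₖ (U : Matrix (Fin d) (Fin d) ℂ)) ∈
      Matrix.unitaryGroup (Fin d × Fin d) ℂ :=
  Matrix.kronecker_mem_unitary U.2 U.2

theorem LinearMap.integral_comp_comm_of_continuous_of_bounded {X E F : Type*} [TopologicalSpace X]
    [MeasurableSpace X] [OpensMeasurableSpace X] {μ : Measure X} [IsFiniteMeasure μ]
    [NormedAddCommGroup E] [NormedSpace ℂ E] [FiniteDimensional ℂ E] [NormedSpace ℝ E]
    [NormedAddCommGroup F] [NormedSpace ℂ F] [CompleteSpace F] [NormedSpace ℝ F]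
    (L : E →ₗ[ℂ] F) {f : X → E} (hf : Continuous f) {C : ℝ} (hC : ∀ x, ‖f x‖ ≤ C) :
    ∫ x, L (f x) ∂μ = L (∫ x, f x ∂μ) := by
  have := FiniteDimensional.proper ℂ E
  have hint : Integrable f μ :=
    Integrable.of_bound hf.aestronglyMeasurable C (Filter.Eventually.of_forall hC)
  exact ContinuousLinearMap.integral_comp_comm (LinearMap.toContinuousLinearMap L) hint

theorem norm_mul_mul_conjTranspose_le {n : Type*} [Fintype n] [DecidableEq n] (A : Matrix n n ℂ)
    {K : Matrix n n ℂ} (hK : K ∈ Matrix.unitaryGroup n ℂ) :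
    ‖K * A * Kᴴ‖ ≤ ∑ q, ∑ p, ‖A p q‖ := by
  refine (Matrix.norm_le_iff (by positivity)).2 fun i j => ?_
  rw [Matrix.mul_apply]
  refine (norm_sum_le _ _).trans (Finset.sum_le_sum fun q _ => ?_)
  rw [norm_mul, Matrix.conjTranspose_apply, norm_star, Matrix.mul_apply]
  refine (mul_le_of_le_one_right (norm_nonneg _) (entry_norm_bound_of_unitary hK j q)).trans ?_
  refine (norm_sum_le _ _).trans (Finset.sum_le_sum fun p _ => ?_)
  rw [norm_mul]
  exact mul_le_of_le_one_left (norm_nonneg _) (entry_norm_bound_of_unitary hK i p)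

theorem continuous_twirl {d : ℕ} (A : Matrix (Fin d × Fin d) (Fin d × Fin d) ℂ) :
    Continuous fun U : Matrix.unitaryGroup (Fin d) ℂ =>
      ((U : Matrix (Fin d) (Fin d) ℂ) ⊗ₖ (U : Matrix (Fin d) (Fin d) ℂ)) * A *
        ((U : Matrix (Fin d) (Fin d) ℂ) ⊗ₖ (U : Matrix (Fin d) (Fin d) ℂ))ᴴ := by
  have hK : Continuous fun U : Matrix.unitaryGroup (Fin d) ℂ =>
      ((U : Matrix (Fin d) (Fin d) ℂ) ⊗ₖ (U : Matrix (Fin d) (Fin d) ℂ)) := by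
    refine continuous_matrix fun p q => ?_
    simp only [kroneckerMap_apply]
    exact (continuous_subtype_val.matrix_elem _ _).mul (continuous_subtype_val.matrix_elem _ _)
  exact (hK.matrix_mul (continuous_const (y := A))).matrix_mul hK.matrix_conjTranspose

theorem linearMap_integral_twirl {d : ℕ} {F : Type*} [NormedAddCommGroup F] [NormedSpace ℂ F]
    [CompleteSpace F] [NormedSpace ℝ F] (A : Matrix (Fin d × Fin d) (Fin d × Fin d) ℂ)
    (μU : Measure (Matrix.unitaryGroup (Fin d) ℂ)) [IsFiniteMeasure μU]
    (L : Matrix (Fin d × Fin d) (Fin d × Fin d) ℂ →ₗ[ℂ] F) :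
    L (∫ U : Matrix.unitaryGroup (Fin d) ℂ,
        ((U : Matrix (Fin d) (Fin d) ℂ) ⊗ₖ (U : Matrix (Fin d) (Fin d) ℂ)) * A *
          ((U : Matrix (Fin d) (Fin d) ℂ) ⊗ₖ (U : Matrix (Fin d) (Fin d) ℂ))ᴴ ∂μU) =
      ∫ U : Matrix.unitaryGroup (Fin d) ℂ,
        L (((U : Matrix (Fin d) (Fin d) ℂ) ⊗ₖ (U : Matrix (Fin d) (Fin d) ℂ)) * A *
          ((U : Matrix (Fin d) (Fin d) ℂ) ⊗ₖ (U : Matrix (Fin d) (Fin d) ℂ))ᴴ) ∂μU :=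
  (LinearMap.integral_comp_comm_of_continuous_of_bounded L (continuous_twirl A) fun U =>
    norm_mul_mul_conjTranspose_le A (kronecker_self_mem_unitaryGroup U)).symm

/-- Schur–Weyl twirl over the unitary group:
`∫ (U ⊗ₖ U) * A * (U ⊗ₖ U)ᴴ dμ_U(U) = a₁ • 1 + a₂ • S`, where
`a₁ = (tr A − d⁻¹ tr(S A))/(d² − 1)` and `a₂ = (tr(S A) − d⁻¹ tr A)/(d² − 1)`. -/
theorem unitary_twirl (d : ℕ) (hd : 2 ≤ d)
    (A : Matrix (Fin d × Fin d) (Fin d × Fin d) ℂ)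
    (μU : Measure (Matrix.unitaryGroup (Fin d) ℂ)) [μU.IsHaarMeasure]
    [IsProbabilityMeasure μU] :
    (∫ U : Matrix.unitaryGroup (Fin d) ℂ,
        ((U : Matrix (Fin d) (Fin d) ℂ) ⊗ₖ (U : Matrix (Fin d) (Fin d) ℂ)) * A *
          ((U : Matrix (Fin d) (Fin d) ℂ) ⊗ₖ (U : Matrix (Fin d) (Fin d) ℂ))ᴴ ∂μU) =
      ((Matrix.trace A - (d : ℂ)⁻¹ * Matrix.trace (swapOp d * A)) / ((d : ℂ) ^ 2 - 1)) •
        (1 : Matrix (Fin d × Fin d) (Fin d × Fin d) ℂ) +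
      ((Matrix.trace (swapOp d * A) - (d : ℂ)⁻¹ * Matrix.trace A) / ((d : ℂ) ^ 2 - 1)) •
        swapOp d := by
  set T := ∫ U : Matrix.unitaryGroup (Fin d) ℂ,
        ((U : Matrix (Fin d) (Fin d) ℂ) ⊗ₖ (U : Matrix (Fin d) (Fin d) ℂ)) * A *
          ((U : Matrix (Fin d) (Fin d) ℂ) ⊗ₖ (U : Matrix (Fin d) (Fin d) ℂ))ᴴ ∂μU with hT
  have hcomm : ∀ V ∈ Matrix.unitaryGroup (Fin d) ℂ, (V ⊗ₖ V) * T = T * (V ⊗ₖ V) := by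
    intro V hV
    have hVV := kronecker_self_mem_unitaryGroup ⟨V, hV⟩
    have hinv : (V ⊗ₖ V) * T * (V ⊗ₖ V)ᴴ = T := by
      have h := linearMap_integral_twirl A μU
        (LinearMap.mulLeft ℂ (V ⊗ₖ V) ∘ₗ LinearMap.mulRight ℂ (V ⊗ₖ V)ᴴ)
      simp only [LinearMap.comp_apply, LinearMap.mulLeft_apply, LinearMap.mulRight_apply] at h
      rw [mul_assoc, hT, h]
      refine (integral_congr_ae (Filter.Eventually.of_forall fun U => ?_)).trans
        (integral_mul_left_eq_self (μ := μU) _ (⟨V, hV⟩ : Matrix.unitaryGroup (Fin d) ℂ))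
      simp [Matrix.mul_kronecker_mul, Matrix.conjTranspose_mul, mul_assoc]
    calc (V ⊗ₖ V) * T = (V ⊗ₖ V) * T * (star (V ⊗ₖ V) * (V ⊗ₖ V)) := by
          rw [Matrix.mem_unitaryGroup_iff'.1 hVV, mul_one]
      _ = T * (V ⊗ₖ V) := by rw [← mul_assoc, Matrix.star_eq_conjTranspose, hinv]
  obtain ⟨a, b, hab⟩ := exists_eq_smul_one_add_smul_swapOp hd T hcomm
  have htr : Matrix.trace T = Matrix.trace A := by
    have h := linearMap_integral_twirl A μU (Matrix.traceLinearMap (Fin d × Fin d) ℂ ℂ)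
    simp only [Matrix.traceLinearMap_apply] at h
    rw [hT, h]
    have (U : Matrix.unitaryGroup (Fin d) ℂ) :
        Matrix.trace (((U : Matrix (Fin d) (Fin d) ℂ) ⊗ₖ (U : Matrix (Fin d) (Fin d) ℂ)) * A *
          ((U : Matrix (Fin d) (Fin d) ℂ) ⊗ₖ (U : Matrix (Fin d) (Fin d) ℂ))ᴴ) =
          Matrix.trace A := by
      rw [Matrix.trace_mul_comm, ← mul_assoc, ← Matrix.star_eq_conjTranspose,
        Matrix.mem_unitaryGroup_iff'.1 (kronecker_self_mem_unitaryGroup U), one_mul]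
    simp [this]
  have htrS : Matrix.trace (swapOp d * T) = Matrix.trace (swapOp d * A) := by
    have h := linearMap_integral_twirl A μU
      (Matrix.traceLinearMap (Fin d × Fin d) ℂ ℂ ∘ₗ LinearMap.mulLeft ℂ (swapOp d))
    simp only [LinearMap.comp_apply, LinearMap.mulLeft_apply, Matrix.traceLinearMap_apply] at h
    rw [hT, h]
    have (U : Matrix.unitaryGroup (Fin d) ℂ) :
        Matrix.trace (swapOp d *
          (((U : Matrix (Fin d) (Fin d) ℂ) ⊗ₖ (U : Matrix (Fin d) (Fin d) ℂ)) * A *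
          ((U : Matrix (Fin d) (Fin d) ℂ) ⊗ₖ (U : Matrix (Fin d) (Fin d) ℂ))ᴴ)) =
          Matrix.trace (swapOp d * A) := by
      rw [← mul_assoc, ← mul_assoc, ← kronecker_self_mul_swapOp, Matrix.trace_mul_comm,
        ← mul_assoc, ← mul_assoc, ← Matrix.star_eq_conjTranspose,
        Matrix.mem_unitaryGroup_iff'.1 (kronecker_self_mem_unitaryGroup U), one_mul]
    simp [this]
  have e₁ : Matrix.trace A = a * d ^ 2 + b * d := by
    rw [← htr, hab]
    simp [trace_swapOp, sq]
  have e₂ : Matrix.trace (swapOp d * A) = a * d + b * d ^ 2 := by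
    rw [← htrS, hab]
    simp [mul_add, swapOp_mul_swapOp, trace_swapOp, sq]
  have hd0 : (d : ℂ) ≠ 0 := by exact_mod_cast (by omega : d ≠ 0)
  have hd1 : (d : ℂ) ^ 2 - 1 ≠ 0 := by
    rw [sub_ne_zero]
    exact_mod_cast (by nlinarith : d ^ 2 ≠ 1)
  rw [hab, e₁, e₂]
  congr 2 <;> field_simp <;> ring
end

section
/- For every matrix C : Matrix (Fin d) (Fin d) ℂ, the squared absolute value of the trace is bounded by the rank times the squared Frobenius norm: ‖trace(C)‖² ≤ (rank C) · Re(trace(Cᴴ * C)). -/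
open Matrix

/-- For every `C : Matrix (Fin d) (Fin d) ℂ`, the squared absolute value of the trace is
bounded by the rank times the squared Frobenius norm:
`‖trace C‖² ≤ rank C · Re(trace(Cᴴ * C))`. -/
theorem sq_norm_trace_le_rank_mul_frobenius (d : ℕ) (C : Matrix (Fin d) (Fin d) ℂ) :
    ‖Matrix.trace C‖ ^ 2 ≤ (C.rank : ℝ) * (Matrix.trace (Cᴴ * C)).re := by
  let V := LinearMap.range (Matrix.toEuclideanLin C)
  have hV : Module.finrank ℂ V = C.rank := by
    rw [C.rank_eq_finrank_range_toLin (PiLp.basisFun 2 ℂ (Fin d)) (PiLp.basisFun 2 ℂ (Fin d)),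
      ← Matrix.toLpLin_eq_toLin]
  let b := stdOrthonormalBasis ℂ V
  let c : Fin d → V := fun j => ⟨_, LinearMap.mem_range_self _ (EuclideanSpace.single j 1)⟩
  have hc (i j : Fin d) : (c j : EuclideanSpace ℂ (Fin d)) i = C i j := by
    simp [c, Matrix.toLpLin_apply]
  have htrace : C.trace = ∑ p : Fin d × Fin (Module.finrank ℂ V),
      inner ℂ (b p.2) (c p.1) * (b p.2 : EuclideanSpace ℂ (Fin d)) p.1 := by
    rw [Fintype.sum_prod_type]
    refine Finset.sum_congr rfl fun j _ => ?_
    have h := congrArg (fun v : V => (v : EuclideanSpace ℂ (Fin d)) j) (b.sum_repr' (c j))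
    simp only [hc] at h
    simpa using h.symm
  have hfrob : ∑ p : Fin d × Fin (Module.finrank ℂ V), ‖inner ℂ (b p.2) (c p.1)‖ ^ 2
      = (Cᴴ * C).trace.re := by
    rw [Fintype.sum_prod_type, Matrix.trace, Complex.re_sum]
    refine Finset.sum_congr rfl fun j _ => ?_
    rw [b.sum_sq_norm_inner_right (c j), Submodule.coe_norm, EuclideanSpace.norm_sq_eq]
    simp [hc, Matrix.mul_apply, Complex.sq_norm, Complex.normSq_apply]
  have hrank : ∑ p : Fin d × Fin (Module.finrank ℂ V),
      ‖(b p.2 : EuclideanSpace ℂ (Fin d)) p.1‖ ^ 2 = C.rank := by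
    rw [Fintype.sum_prod_type_right]
    simp_rw [← EuclideanSpace.norm_sq_eq, ← Submodule.coe_norm, b.norm_eq_one]
    simp [hV]
  calc ‖C.trace‖ ^ 2
      ≤ (∑ p : Fin d × Fin (Module.finrank ℂ V),
          ‖inner ℂ (b p.2) (c p.1)‖ * ‖(b p.2 : EuclideanSpace ℂ (Fin d)) p.1‖) ^ 2 := by
        rw [htrace]
        gcongr
        exact (norm_sum_le _ _).trans_eq (by simp only [norm_mul])
    _ ≤ _ := Finset.sum_mul_sq_le_sq_mul_sq _ _ _
    _ = _ := by rw [hfrob, hrank, mul_comm]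
end

section
/- (Fidelity bound for pure states of bounded Schmidt rank.) Let d ≥ 1, let μ be a natural number, and let ψ ∈ ℂ^(Fin d × Fin d) be a unit vector whose coefficient matrix C (with C_{jk} = ψ_{(j,k)}) has rank C ≤ μ. Then ‖⟪φ⁺, ψ⟫‖² ≤ μ/d, where ⟪·,·⟫ is the standard Hermitian inner product. -/
open Matrix
open scoped ComplexConjugate

/-- The maximally entangled vector `φ⁺`, with components `φ⁺_{(j,k)} = δ_{jk}/√d`. -/
noncomputable def phiPlus (d : ℕ) : Fin d × Fin d → ℂ :=
  fun p => if p.1 = p.2 then ((Real.sqrt d : ℝ) : ℂ)⁻¹ else 0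

/-- The squared modulus of the trace of a square matrix is at most its rank times its squared
Frobenius norm. -/
theorem Matrix.sq_norm_trace_le_rank_mul {𝕜 n : Type*} [RCLike 𝕜] [Fintype n]
    (A : Matrix n n 𝕜) :
    ‖A.trace‖ ^ 2 ≤ A.rank * ∑ j, ∑ k, ‖A j k‖ ^ 2 := by
  let e := (WithLp.linearEquiv 2 𝕜 (n → 𝕜)).symm
  let S : Submodule 𝕜 (EuclideanSpace 𝕜 n) :=
    (Submodule.span 𝕜 (Set.range A.col)).map e.toLinearMap
  have hS : Module.finrank 𝕜 S = A.rank := by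
    rw [A.rank_eq_finrank_span_cols]
    exact LinearEquiv.finrank_map_eq e _
  let c (k : n) : S :=
    ⟨e (A.col k), Submodule.mem_map_of_mem (Submodule.subset_span ⟨k, rfl⟩)⟩
  let b := stdOrthonormalBasis 𝕜 S
  have hc (k : n) : ∑ i, ‖inner 𝕜 (b i) (c k)‖ ^ 2 = ∑ j, ‖A j k‖ ^ 2 := by
    rw [b.sum_sq_norm_inner_right, Submodule.coe_norm, EuclideanSpace.norm_sq_eq]
    rfl
  have hb (i) : ∑ k, ‖(b i : EuclideanSpace 𝕜 n) k‖ ^ 2 = 1 := by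
    rw [← EuclideanSpace.norm_sq_eq, ← Submodule.coe_norm, b.norm_eq_one, one_pow]
  have hA (k : n) : A k k = ∑ i, inner 𝕜 (b i) (c k) * (b i : EuclideanSpace 𝕜 n) k := by
    have h := congrArg (fun v : S => (v : EuclideanSpace 𝕜 n) k) (b.sum_repr' (c k))
    simpa [c, e] using h.symm
  have htr : ‖A.trace‖ ≤
      ∑ p : n × Fin (Module.finrank 𝕜 S),
        ‖inner 𝕜 (b p.2) (c p.1)‖ * ‖(b p.2 : EuclideanSpace 𝕜 n) p.1‖ := by
    simp only [Matrix.trace, Matrix.diag_apply, hA, ← Fintype.sum_prod_type', ← norm_mul]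
    exact norm_sum_le _ _
  calc ‖A.trace‖ ^ 2
      ≤ _ := pow_le_pow_left₀ (norm_nonneg _) htr 2
    _ ≤ _ := Finset.sum_mul_sq_le_sq_mul_sq _ _ _
    _ = A.rank * ∑ j, ∑ k, ‖A j k‖ ^ 2 := by
      rw [Fintype.sum_prod_type, Fintype.sum_prod_type_right,
        Finset.sum_comm (f := fun j k => ‖A j k‖ ^ 2)]
      simp only [hc, hb, Finset.sum_const, Finset.card_univ, Fintype.card_fin, hS,
        nsmul_eq_mul, mul_one]
      ring

/-- Fidelity bound for pure states of bounded Schmidt rank: if `ψ` is a unit vector in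
`ℂ^(Fin d × Fin d)` whose coefficient matrix `C` (with `C_{jk} = ψ_{(j,k)}`) has rank at most
`μ`, then `‖⟪φ⁺, ψ⟫‖² ≤ μ/d`. -/
theorem sq_norm_inner_phiPlus_le (d μ : ℕ) (hd : 1 ≤ d) (ψ : Fin d × Fin d → ℂ)
    (hψ : ∑ x : Fin d × Fin d, ‖ψ x‖ ^ 2 = 1)
    (hrank : (Matrix.of fun j k : Fin d => ψ (j, k)).rank ≤ μ) :
    ‖∑ x : Fin d × Fin d, conj (phiPlus d x) * ψ x‖ ^ 2 ≤ (μ : ℝ) / d := by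
  let A : Matrix (Fin d) (Fin d) ℂ := Matrix.of fun j k => ψ (j, k)
  have hinner : ∑ x : Fin d × Fin d, conj (phiPlus d x) * ψ x =
      ((Real.sqrt d : ℝ) : ℂ)⁻¹ * A.trace := by
    simp [Fintype.sum_prod_type, phiPlus, A, Matrix.trace, Finset.mul_sum, apply_ite conj]
  have hA : ∑ j, ∑ k, ‖A j k‖ ^ 2 = 1 := by
    rw [← hψ, Fintype.sum_prod_type]
    rfl
  have htr := A.sq_norm_trace_le_rank_mul
  rw [hA, mul_one] at htr
  rw [hinner, norm_mul, mul_pow, norm_inv, Complex.norm_real, inv_pow, Real.norm_eq_abs, sq_abs,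
    Real.sq_sqrt d.cast_nonneg, div_eq_inv_mul]
  gcongr
  exact htr.trans (Nat.cast_le.mpr hrank)
end

section
/- (Observation 1, Schmidt number lower bound.) Let d ≥ 1 and let μ be a natural number. Suppose ρ = Σ_{i ∈ I} p_i · ψ_i (ψ_i)ᴴ is a finite convex combination (p_i ≥ 0, Σ p_i = 1) of rank-one projections onto unit vectors ψ_i ∈ ℂ^(Fin d × Fin d), each of Schmidt rank ≤ μ, and let F = Re(trace(ρ * P)) with P = φ⁺ (φ⁺)ᴴ. If F > 0 then μ ≥ ⌈d · F⌉ (natural-number ceiling of the real number d·F). -/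
open Matrix

/-- The projection `P = φ⁺ (φ⁺)ᴴ` onto the maximally entangled vector. -/
noncomputable def mesProj (d : ℕ) : Matrix (Fin d × Fin d) (Fin d × Fin d) ℂ :=
  Matrix.vecMulVec (phiPlus d) (star (phiPlus d))

/-- The squared modulus of the trace of a square complex matrix is at most its rank times its
squared Frobenius norm. -/
theorem norm_trace_sq_le_rank_mul_sum {n : Type*} [Fintype n] (C : Matrix n n ℂ) :
    ‖C.trace‖ ^ 2 ≤ C.rank * ∑ j, ∑ k, ‖C j k‖ ^ 2 := by
  classical
  let S : Submodule ℂ (EuclideanSpace ℂ n) :=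
    Submodule.span ℂ (Set.range fun k => WithLp.toLp 2 (C.col k))
  let c : n → S := fun k => ⟨WithLp.toLp 2 (C.col k), Submodule.subset_span ⟨k, rfl⟩⟩
  let u := stdOrthonormalBasis ℂ S
  have hS : Module.finrank ℂ S = C.rank := by
    have hmap : S = (Submodule.span ℂ (Set.range C.col)).map
        (WithLp.linearEquiv 2 ℂ (n → ℂ)).symm.toLinearMap := by
      rw [Submodule.map_span, ← Set.range_comp]
      rfl
    rw [hmap, LinearEquiv.finrank_map_eq, rank_eq_finrank_span_cols]
  have htrace : C.trace =
      ∑ x : n × Fin (Module.finrank ℂ S),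
        inner ℂ (u x.2) (c x.1) * (u x.2 : EuclideanSpace ℂ n) x.1 := by
    rw [Fintype.sum_prod_type]
    refine Finset.sum_congr rfl fun k _ => ?_
    have h := congrArg (fun s : S => (s : EuclideanSpace ℂ n) k) (u.sum_repr' (c k))
    simpa [c] using h.symm
  have hu : ∑ x : n × Fin (Module.finrank ℂ S), ‖(u x.2 : EuclideanSpace ℂ n) x.1‖ ^ 2 =
      C.rank := by
    rw [Fintype.sum_prod_type_right]
    have h (a) : ∑ k, ‖(u a : EuclideanSpace ℂ n) k‖ ^ 2 = 1 := by
      rw [← EuclideanSpace.norm_sq_eq, Submodule.norm_coe, u.norm_eq_one, one_pow]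
    simp [h, hS]
  have hc : ∑ x : n × Fin (Module.finrank ℂ S), ‖inner ℂ (u x.2) (c x.1)‖ ^ 2 =
      ∑ j, ∑ k, ‖C j k‖ ^ 2 := by
    rw [Fintype.sum_prod_type, Finset.sum_comm (f := fun j k => ‖C j k‖ ^ 2)]
    refine Finset.sum_congr rfl fun k _ => ?_
    refine (u.sum_sq_norm_inner_right (c k)).trans ?_
    rw [← Submodule.norm_coe, EuclideanSpace.norm_sq_eq]
    rfl
  calc ‖C.trace‖ ^ 2
      ≤ (∑ x : n × Fin (Module.finrank ℂ S),
          ‖inner ℂ (u x.2) (c x.1)‖ * ‖(u x.2 : EuclideanSpace ℂ n) x.1‖) ^ 2 := by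
        rw [htrace]
        gcongr
        exact (norm_sum_le _ _).trans_eq (by simp only [norm_mul])
    _ ≤ _ := Finset.sum_mul_sq_le_sq_mul_sq _ _ _
    _ = _ := by rw [hu, hc, mul_comm]

/-- The overlap of a pure state with the maximally entangled state, in terms of the trace of its
coefficient matrix. -/
theorem trace_vecMulVec_mul_mesProj (d : ℕ) (ψ : Fin d × Fin d → ℂ) :
    (vecMulVec ψ (star ψ) * mesProj d).trace =
      ((‖(Matrix.of fun j k : Fin d => ψ (j, k)).trace‖ ^ 2 / d : ℝ) : ℂ) := by
  set t := (Matrix.of fun j k : Fin d => ψ (j, k)).trace with ht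
  have h : ψ ⬝ᵥ star (phiPlus d) = t * ((Real.sqrt d : ℝ) : ℂ)⁻¹ := by
    simp [dotProduct, phiPlus, Fintype.sum_prod_type, ht, Matrix.trace, Finset.sum_mul,
      apply_ite (starRingEnd ℂ)]
  have h' : star ψ ⬝ᵥ phiPlus d = star t * ((Real.sqrt d : ℝ) : ℂ)⁻¹ := by
    rw [star_dotProduct, dotProduct_comm, h]
    simp
  have hd : ((Real.sqrt d : ℝ) : ℂ) * ((Real.sqrt d : ℝ) : ℂ) = d := by
    rw [← Complex.ofReal_mul, Real.mul_self_sqrt d.cast_nonneg, Complex.ofReal_natCast]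
  rw [mesProj, vecMulVec_mul_vecMulVec, vecMulVec_smul, trace_smul, trace_vecMulVec, h, h']
  push_cast
  rw [← Complex.mul_conj', ← hd, smul_eq_mul, div_eq_mul_inv, mul_inv, ← starRingEnd_apply]
  ring

/-- Observation 1, Schmidt number lower bound: if `ρ` is a finite convex combination of
rank-one projections onto unit vectors of Schmidt rank at most `μ`, and the fidelity
`F = Re(trace(ρ * P))` is positive, then `μ ≥ ⌈d · F⌉`. -/
theorem schmidt_number_lower_bound (d μ : ℕ) (hd : 1 ≤ d)
    {I : Type} [Fintype I] (p : I → ℝ) (ψ : I → Fin d × Fin d → ℂ)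
    (hp : ∀ i, 0 ≤ p i) (hpsum : ∑ i, p i = 1)
    (hunit : ∀ i, ∑ x : Fin d × Fin d, ‖ψ i x‖ ^ 2 = 1)
    (hrank : ∀ i, (Matrix.of fun j k : Fin d => ψ i (j, k)).rank ≤ μ)
    (ρ : Matrix (Fin d × Fin d) (Fin d × Fin d) ℂ)
    (hρ : ρ = ∑ i, (p i : ℂ) • Matrix.vecMulVec (ψ i) (star (ψ i)))
    (hF : 0 < (Matrix.trace (ρ * mesProj d)).re) :
    ⌈(d : ℝ) * (Matrix.trace (ρ * mesProj d)).re⌉₊ ≤ μ := by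
  apply Nat.ceil_le.mpr
  have hd₀ : (d : ℝ) ≠ 0 := by positivity
  have hF_eq : (d : ℝ) * (Matrix.trace (ρ * mesProj d)).re =
      ∑ i, p i * ‖(Matrix.of fun j k : Fin d => ψ i (j, k)).trace‖ ^ 2 := by
    simp only [hρ, Finset.sum_mul, trace_sum, smul_mul, trace_smul, trace_vecMulVec_mul_mesProj,
      smul_eq_mul, ← Complex.ofReal_mul, Complex.re_sum, Complex.ofReal_re, Finset.mul_sum]
    refine Finset.sum_congr rfl fun i _ => ?_
    field_simp
  have hle (i : I) : ‖(Matrix.of fun j k : Fin d => ψ i (j, k)).trace‖ ^ 2 ≤ μ := by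
    refine (norm_trace_sq_le_rank_mul_sum _).trans ?_
    simp only [of_apply]
    rw [← Fintype.sum_prod_type (fun x => ‖ψ i x‖ ^ 2), hunit i, mul_one]
    exact_mod_cast hrank i
  rw [hF_eq]
  calc _ ≤ ∑ i, p i * (μ : ℝ) :=
        Finset.sum_le_sum fun i _ => mul_le_mul_of_nonneg_left (hle i) (hp i)
    _ = μ := by rw [← Finset.sum_mul, hpsum, one_mul]
end

section
/- (First orthogonal moment for a general antisymmetric observable.) Let d ≥ 2, let ρ be a density matrix on ℂ^(Fin d × Fin d), and let M̂ : Matrix (Fin d) (Fin d) ℂ be Hermitian with M̂ᵀ = −M̂. Then ∫ trace[ρ * (O ⊗ₖ O) * (M̂ ⊗ₖ M̂) * (O ⊗ₖ O)ᵀ] dμ_O(O) = (trace(M̂*M̂)/(d(d−1))) · trace[ρ*(S − S^{T_B})]. -/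
open Matrix MeasureTheory
open scoped Kronecker ComplexOrder

/-- Partial transpose on the second subsystem: `(X^{T_B})_{(i,j),(k,l)} = X_{(i,l),(k,j)}`. -/
def ptB {d : ℕ} (X : Matrix (Fin d × Fin d) (Fin d × Fin d) ℂ) :
    Matrix (Fin d × Fin d) (Fin d × Fin d) ℂ :=
  Matrix.of fun p q => X (p.1, q.2) (q.1, p.2)

noncomputable instance (d : ℕ) : MeasurableSpace (Matrix.orthogonalGroup (Fin d) ℝ) := borel _
instance (d : ℕ) : BorelSpace (Matrix.orthogonalGroup (Fin d) ℝ) := ⟨rfl⟩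

/-- The conjugate `O M Oᵀ` of a complex matrix by a real orthogonal one. -/
noncomputable def orthogonalConj {d : ℕ} (M : Matrix (Fin d) (Fin d) ℂ)
    (O : Matrix.orthogonalGroup (Fin d) ℝ) : Matrix (Fin d) (Fin d) ℂ :=
  (O : Matrix (Fin d) (Fin d) ℝ).map Complex.ofReal * M *
    ((O : Matrix (Fin d) (Fin d) ℝ).map Complex.ofReal)ᵀ

section OrthogonalConj

variable {d : ℕ} (M : Matrix (Fin d) (Fin d) ℂ)

theorem orthogonalConj_apply (O : Matrix.orthogonalGroup (Fin d) ℝ) (i k : Fin d) :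
    orthogonalConj M O i k = ∑ b, ∑ a,
      (((O : Matrix (Fin d) (Fin d) ℝ) i a : ℝ) : ℂ) * M a b *
        (((O : Matrix (Fin d) (Fin d) ℝ) k b : ℝ) : ℂ) := by
  simp [orthogonalConj, Matrix.mul_apply, Finset.sum_mul]

theorem orthogonalConj_mul (W O : Matrix.orthogonalGroup (Fin d) ℝ) :
    orthogonalConj M (W * O) = orthogonalConj (orthogonalConj M O) W := by
  have h : ((W * O : Matrix.orthogonalGroup (Fin d) ℝ) : Matrix (Fin d) (Fin d) ℝ).map
      Complex.ofReal = (W : Matrix (Fin d) (Fin d) ℝ).map Complex.ofReal *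
        (O : Matrix (Fin d) (Fin d) ℝ).map Complex.ofReal :=
    Matrix.map_mul (f := Complex.ofRealHom)
  simp only [orthogonalConj, h, Matrix.transpose_mul, Matrix.mul_assoc]

theorem orthogonalConj_transpose (hM : Mᵀ = -M) (O : Matrix.orthogonalGroup (Fin d) ℝ) :
    (orthogonalConj M O)ᵀ = -orthogonalConj M O := by
  simp [orthogonalConj, Matrix.transpose_mul, hM, Matrix.mul_assoc]

theorem trace_orthogonalConj_mul_self (O : Matrix.orthogonalGroup (Fin d) ℝ) :
    (orthogonalConj M O * orthogonalConj M O).trace = (M * M).trace := by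
  have h : ((O : Matrix (Fin d) (Fin d) ℝ).map Complex.ofReal)ᵀ *
      (O : Matrix (Fin d) (Fin d) ℝ).map Complex.ofReal = 1 := by
    have h1 := (Matrix.mem_orthogonalGroup_iff' (Fin d) ℝ).1 O.2
    have h2 := congrArg (fun A => A.map Complex.ofRealHom) h1
    rw [Matrix.map_mul, Matrix.map_one _ (map_zero _) (map_one _)] at h2
    exact h2
  unfold orthogonalConj
  generalize (O : Matrix (Fin d) (Fin d) ℝ).map Complex.ofReal = A at h
  calc (A * M * Aᵀ * (A * M * Aᵀ)).trace = (A * (M * (Aᵀ * A) * M * Aᵀ)).trace := by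
        simp only [Matrix.mul_assoc]
    _ = (M * M * (Aᵀ * A)).trace := by
        rw [Matrix.trace_mul_comm, h]
        simp only [Matrix.mul_one, Matrix.mul_assoc, h]
    _ = (M * M).trace := by rw [h, Matrix.mul_one]

theorem continuous_orthogonalConj_apply (i k : Fin d) :
    Continuous fun O => orthogonalConj M O i k := by
  simp only [orthogonalConj_apply]
  have h (a b : Fin d) : Continuous fun O : Matrix.orthogonalGroup (Fin d) ℝ =>
      (((O : Matrix (Fin d) (Fin d) ℝ) a b : ℝ) : ℂ) :=
    Complex.continuous_ofReal.comp (continuous_subtype_val.matrix_elem a b)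
  exact continuous_finsetSum _ fun b _ => continuous_finsetSum _ fun a _ =>
    ((h i a).mul continuous_const).mul (h k b)

theorem norm_orthogonalConj_apply_le (O : Matrix.orthogonalGroup (Fin d) ℝ) (i k : Fin d) :
    ‖orthogonalConj M O i k‖ ≤ ∑ b, ∑ a, ‖M a b‖ := by
  rw [orthogonalConj_apply]
  refine (norm_sum_le _ _).trans (Finset.sum_le_sum fun b _ => (norm_sum_le _ _).trans
    (Finset.sum_le_sum fun a _ => ?_))
  have h (x y : Fin d) : ‖(((O : Matrix (Fin d) (Fin d) ℝ) x y : ℝ) : ℂ)‖ ≤ 1 := by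
    rw [Complex.norm_real]
    exact entry_norm_bound_of_unitary O.2 x y
  rw [norm_mul, norm_mul]
  calc _ ≤ 1 * ‖M a b‖ * 1 := by gcongr <;> exact h _ _
    _ = ‖M a b‖ := by ring

theorem integrable_orthogonalConj_mul (μ : Measure (Matrix.orthogonalGroup (Fin d) ℝ))
    [IsFiniteMeasure μ] (i k j l : Fin d) :
    Integrable (fun O => orthogonalConj M O i k * orthogonalConj M O j l) μ := by
  refine Integrable.of_bound ((continuous_orthogonalConj_apply M i k).mul
    (continuous_orthogonalConj_apply M j l)).aestronglyMeasurable
    ((∑ b, ∑ a, ‖M a b‖) * ∑ b, ∑ a, ‖M a b‖) (.of_forall fun O => ?_)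
  rw [norm_mul]
  exact mul_le_mul (norm_orthogonalConj_apply_le M O i k) (norm_orthogonalConj_apply_le M O j l)
    (norm_nonneg _) ((norm_nonneg _).trans (norm_orthogonalConj_apply_le M O i k))

/-- The diagonal reflection that flips the sign of the coordinate `a`. -/
noncomputable def coordinateReflection (a : Fin d) : Matrix.orthogonalGroup (Fin d) ℝ :=
  ⟨Matrix.diagonal fun x => if x = a then -1 else 1, by
    rw [Matrix.mem_orthogonalGroup_iff, Matrix.diagonal_transpose, Matrix.diagonal_mul_diagonal,
      ← Matrix.diagonal_one]
    congr 1
    ext x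
    split_ifs <;> simp⟩

theorem orthogonalConj_coordinateReflection (a i k : Fin d) :
    orthogonalConj M (coordinateReflection a) i k =
      (if i = a then -1 else 1) * M i k * (if k = a then -1 else 1) := by
  simp only [orthogonalConj, coordinateReflection, Complex.ofReal_zero, Matrix.diagonal_map,
    Matrix.diagonal_transpose, Matrix.mul_diagonal, Matrix.diagonal_mul]
  split_ifs <;> simp

/-- The orthogonal matrix of a permutation of the coordinates. -/
noncomputable def coordinatePermutation (σ : Equiv.Perm (Fin d)) :
    Matrix.orthogonalGroup (Fin d) ℝ :=
  ⟨(1 : Matrix (Fin d) (Fin d) ℝ).submatrix σ id, by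
    rw [Matrix.mem_orthogonalGroup_iff]
    ext i j
    simp [Matrix.mul_apply, Matrix.one_apply]⟩

theorem orthogonalConj_coordinatePermutation (σ : Equiv.Perm (Fin d)) (i k : Fin d) :
    orthogonalConj M (coordinatePermutation σ) i k = M (σ i) (σ k) := by
  simp [orthogonalConj_apply, coordinatePermutation, Matrix.one_apply, apply_ite Complex.ofReal]

end OrthogonalConj

theorem exists_perm_apply_eq_apply_eq {α : Type*} [DecidableEq α] {a b i k : α} (hab : a ≠ b)
    (hik : i ≠ k) : ∃ σ : Equiv.Perm α, σ a = i ∧ σ b = k := by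
  refine ⟨Equiv.swap (Equiv.swap a i b) k * Equiv.swap a i, ?_, by simp⟩
  have h : i ≠ Equiv.swap a i b := fun h => hab (by
    simpa using congrArg (Equiv.swap a i) h)
  rw [Equiv.Perm.mul_apply, Equiv.swap_apply_left, Equiv.swap_apply_of_ne_of_ne h hik]

section Moment

variable {d : ℕ} (M : Matrix (Fin d) (Fin d) ℂ) (μ : Measure (Matrix.orthogonalGroup (Fin d) ℝ))

/-- The second moments of the entries of `O M Oᵀ`. -/
noncomputable def orthogonalConjMoment (i k j l : Fin d) : ℂ :=
  ∫ O, orthogonalConj M O i k * orthogonalConj M O j l ∂μ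

variable {M}

theorem orthogonalConjMoment_swap_left (hM : Mᵀ = -M) (i k j l : Fin d) :
    orthogonalConjMoment M μ k i j l = -orthogonalConjMoment M μ i k j l := by
  rw [orthogonalConjMoment, orthogonalConjMoment, ← integral_neg]
  congr 1
  ext O
  have h := congrFun₂ (orthogonalConj_transpose M hM O) i k
  simp only [Matrix.transpose_apply, Matrix.neg_apply] at h
  rw [h, neg_mul]

theorem orthogonalConjMoment_comm (i k j l : Fin d) :
    orthogonalConjMoment M μ j l i k = orthogonalConjMoment M μ i k j l := by
  simp only [orthogonalConjMoment, mul_comm]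

theorem orthogonalConjMoment_swap_right (hM : Mᵀ = -M) (i k j l : Fin d) :
    orthogonalConjMoment M μ i k l j = -orthogonalConjMoment M μ i k j l := by
  rw [orthogonalConjMoment_comm, orthogonalConjMoment_swap_left μ hM, orthogonalConjMoment_comm]

theorem orthogonalConjMoment_perm [μ.IsMulLeftInvariant] (σ : Equiv.Perm (Fin d))
    (i k j l : Fin d) :
    orthogonalConjMoment M μ (σ i) (σ k) (σ j) (σ l) = orthogonalConjMoment M μ i k j l := by
  conv_rhs =>
    rw [orthogonalConjMoment, ← integral_mul_left_eq_self _ (coordinatePermutation σ)]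
  simp [orthogonalConjMoment, orthogonalConj_mul, orthogonalConj_coordinatePermutation]

theorem orthogonalConjMoment_eq_zero [μ.IsMulLeftInvariant] {i k j l : Fin d}
    (hik : i ≠ k) (hij : i ≠ j) (hil : i ≠ l) : orthogonalConjMoment M μ i k j l = 0 := by
  have h : orthogonalConjMoment M μ i k j l = -orthogonalConjMoment M μ i k j l := by
    conv_lhs => rw [orthogonalConjMoment, ← integral_mul_left_eq_self _ (coordinateReflection i)]
    simp [orthogonalConjMoment, orthogonalConj_mul, orthogonalConj_coordinateReflection, hik.symm,
      hij.symm, hil.symm, integral_neg]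
  exact self_eq_neg.1 h

theorem orthogonalConjMoment_eq [μ.IsMulLeftInvariant] (hM : Mᵀ = -M) {a b : Fin d} (hab : a ≠ b)
    (i k j l : Fin d) :
    orthogonalConjMoment M μ i k j l = orthogonalConjMoment M μ a b a b *
      ((if i = j ∧ k = l then 1 else 0) - if i = l ∧ k = j then 1 else 0) := by
  have key {i k l : Fin d} (hik : i ≠ k) (hil : i ≠ l) :
      orthogonalConjMoment M μ i k i l =
        orthogonalConjMoment M μ a b a b * if k = l then 1 else 0 := by
    split_ifs with hkl
    · subst hkl
      obtain ⟨σ, rfl, rfl⟩ := exists_perm_apply_eq_apply_eq hab hik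
      rw [orthogonalConjMoment_perm, mul_one]
    · rw [orthogonalConjMoment_swap_left μ hM k i,
        orthogonalConjMoment_eq_zero μ hik.symm hik.symm hkl, neg_zero, mul_zero]
  by_cases hik : i = k
  · subst hik
    rw [self_eq_neg.1 (orthogonalConjMoment_swap_left μ hM i i j l)]
    simp [and_comm]
  by_cases hjl : j = l
  · subst hjl
    rw [self_eq_neg.1 (orthogonalConjMoment_swap_right μ hM i k j j)]
    simp
  by_cases hij : i = j
  · subst hij
    rw [key hik hjl]
    simp [hjl]
  by_cases hil : i = l
  · subst hil
    rw [orthogonalConjMoment_swap_right μ hM i k i j, key hik hij]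
    simp [hij]
  · rw [orthogonalConjMoment_eq_zero μ hik hij hil]
    simp [hij, hil]

theorem sum_orthogonalConjMoment [IsProbabilityMeasure μ] :
    ∑ i, ∑ k, orthogonalConjMoment M μ i k k i = (M * M).trace := by
  have h : ∫ O, (orthogonalConj M O * orthogonalConj M O).trace ∂μ = (M * M).trace := by
    simp [trace_orthogonalConj_mul_self]
  rw [← h]
  simp only [Matrix.trace, Matrix.diag_apply, Matrix.mul_apply]
  rw [integral_finsetSum _ fun i _ => integrable_finsetSum _ fun k _ =>
    integrable_orthogonalConj_mul M μ i k k i]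
  refine Finset.sum_congr rfl fun i _ => ?_
  rw [integral_finsetSum _ fun k _ => integrable_orthogonalConj_mul M μ i k k i]
  rfl

theorem orthogonalConjMoment_eq_trace_div [μ.IsMulLeftInvariant] [IsProbabilityMeasure μ]
    (hd : 2 ≤ d) (hM : Mᵀ = -M) (i k j l : Fin d) :
    orthogonalConjMoment M μ i k j l = (M * M).trace / ((d : ℂ) * (d - 1)) *
      ((if i = l ∧ k = j then 1 else 0) - if i = j ∧ k = l then 1 else 0) := by
  have hab : (⟨0, by omega⟩ : Fin d) ≠ ⟨1, by omega⟩ := by simp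
  have hmoment := orthogonalConjMoment_eq μ hM hab
  generalize orthogonalConjMoment M μ ⟨0, _⟩ ⟨1, _⟩ ⟨0, _⟩ ⟨1, _⟩ = e at hmoment
  have hsum : e * -((d : ℂ) * (d - 1)) = (M * M).trace := by
    have h (i k : Fin d) : (i = k ∧ k = i) ↔ i = k := ⟨And.left, fun h => ⟨h, h.symm⟩⟩
    rw [← sum_orthogonalConjMoment (M := M) μ]
    simp [hmoment, h, ← Finset.mul_sum]
    ring
  have hd0 : (d : ℂ) ≠ 0 := by
    exact_mod_cast (by omega : d ≠ 0)
  have hd1 : (d : ℂ) - 1 ≠ 0 := sub_ne_zero.2 (by exact_mod_cast (by omega : d ≠ 1))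
  rw [hmoment, ← hsum]
  field_simp
  ring

end Moment

/-- First orthogonal moment for a general Hermitian antisymmetric observable `M̂`:
`∫ tr[ρ (O ⊗ₖ O)(M̂ ⊗ₖ M̂)(O ⊗ₖ O)ᵀ] dμ_O(O) = (tr(M̂²)/(d(d−1))) · tr[ρ (S − S^{T_B})]`. -/
theorem orthogonal_first_moment_general (d : ℕ) (hd : 2 ≤ d)
    (ρ : Matrix (Fin d × Fin d) (Fin d × Fin d) ℂ) (hρ : ρ.PosSemidef)
    (hρtr : Matrix.trace ρ = 1)
    (Mhat : Matrix (Fin d) (Fin d) ℂ) (hMhat : Mhat.IsHermitian) (hMhatT : Mhatᵀ = -Mhat)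
    (μO : Measure (Matrix.orthogonalGroup (Fin d) ℝ)) [μO.IsHaarMeasure]
    [IsProbabilityMeasure μO] :
    (∫ O : Matrix.orthogonalGroup (Fin d) ℝ,
        Matrix.trace (ρ *
          ((((O : Matrix (Fin d) (Fin d) ℝ).map Complex.ofReal) ⊗ₖ
              ((O : Matrix (Fin d) (Fin d) ℝ).map Complex.ofReal)) * (Mhat ⊗ₖ Mhat) *
            ((((O : Matrix (Fin d) (Fin d) ℝ).map Complex.ofReal) ⊗ₖ
              ((O : Matrix (Fin d) (Fin d) ℝ).map Complex.ofReal)))ᵀ)) ∂μO) =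
      (Matrix.trace (Mhat * Mhat) / ((d : ℂ) * (d - 1))) *
        Matrix.trace (ρ * (swapOp d - ptB (swapOp d))) := by
  have hconj (O : Matrix.orthogonalGroup (Fin d) ℝ) :
      Matrix.trace (ρ *
          ((((O : Matrix (Fin d) (Fin d) ℝ).map Complex.ofReal) ⊗ₖ
              ((O : Matrix (Fin d) (Fin d) ℝ).map Complex.ofReal)) * (Mhat ⊗ₖ Mhat) *
            ((((O : Matrix (Fin d) (Fin d) ℝ).map Complex.ofReal) ⊗ₖ
              ((O : Matrix (Fin d) (Fin d) ℝ).map Complex.ofReal)))ᵀ)) =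
        ∑ p, ∑ q, ρ p q * (orthogonalConj Mhat O q.1 p.1 * orthogonalConj Mhat O q.2 p.2) := by
    rw [← Matrix.kroneckerMap_transpose, ← Matrix.mul_kronecker_mul, ← Matrix.mul_kronecker_mul]
    rfl
  have hint (p q : Fin d × Fin d) :=
    (integrable_orthogonalConj_mul Mhat μO q.1 p.1 q.2 p.2).const_mul (ρ p q)
  simp only [hconj]
  rw [integral_finsetSum _ fun p _ => integrable_finsetSum _ fun q _ => hint p q]
  have htrace : Matrix.trace (ρ * (swapOp d - ptB (swapOp d))) =
      ∑ p, ∑ q, ρ p q * (swapOp d - ptB (swapOp d)) q p := rfl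
  simp only [htrace, Finset.mul_sum]
  refine Finset.sum_congr rfl fun p _ => ?_
  rw [integral_finsetSum _ fun q _ => hint p q]
  refine Finset.sum_congr rfl fun q _ => ?_
  rw [integral_const_mul]
  change ρ p q * orthogonalConjMoment Mhat μO q.1 p.1 q.2 p.2 = _
  rw [orthogonalConjMoment_eq_trace_div μO hd hMhatT]
  simp only [swapOp, ptB, Matrix.sub_apply, Matrix.of_apply,
    eq_comm (a := q.2) (b := p.1), eq_comm (a := p.2) (b := p.1)]
  ring
end

section
/- (Separable states have low fidelity with the maximally entangled state.) Let d ≥ 1 and let σ be a separable density matrix on ℂ^(Fin d × Fin d). Then Re(trace(σ * P)) ≤ 1/d, where P = φ⁺ (φ⁺)ᴴ. -/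
open Matrix
open scoped Kronecker

/-- A density matrix `σ` on `ℂ^(Fin d × Fin d)` is separable if it is a finite convex
combination of Kronecker products of rank-one projections onto unit vectors. -/
def IsSeparable' {d : ℕ} (σ : Matrix (Fin d × Fin d) (Fin d × Fin d) ℂ) : Prop :=
  ∃ (I : Type) (_ : Fintype I) (p : I → ℝ) (a b : I → Fin d → ℂ),
    (∀ i, 0 ≤ p i) ∧ (∑ i, p i = 1) ∧
    (∀ i, ∑ x : Fin d, ‖a i x‖ ^ 2 = 1) ∧ (∀ i, ∑ x : Fin d, ‖b i x‖ ^ 2 = 1) ∧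
    σ = ∑ i, (p i : ℂ) •
      (Matrix.vecMulVec (a i) (star (a i)) ⊗ₖ Matrix.vecMulVec (b i) (star (b i)))

/-- The Kronecker product of two rank-one matrices is the rank-one matrix of the tensor
products of the vectors. -/
theorem vecMulVec_kronecker_vecMulVec_eq {R m n m' n' : Type*} [CommSemiring R]
    (a : m → R) (a' : n → R) (b : m' → R) (b' : n' → R) :
    vecMulVec a a' ⊗ₖ vecMulVec b b' =
      vecMulVec (fun q : m × m' => a q.1 * b q.2) (fun q : n × n' => a' q.1 * b' q.2) := by
  ext q r
  simp only [kroneckerMap_apply, vecMulVec_apply]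
  ring

/-- The overlap of two rank-one projections is `|⟨v, u⟩|²`. -/
theorem trace_vecMulVec_star_mul_vecMulVec_star {n : Type*} [Fintype n] (u v : n → ℂ) :
    trace (vecMulVec u (star u) * vecMulVec v (star v)) = ((‖star v ⬝ᵥ u‖ ^ 2 : ℝ) : ℂ) := by
  have h : star u ⬝ᵥ v = star (star v ⬝ᵥ u) := by rw [star_dotProduct]
  rw [vecMulVec_mul_vecMulVec, trace_vecMulVec, dotProduct_comm, h]
  simp only [smul_dotProduct, smul_eq_mul, Complex.star_def]
  rw [Complex.conj_mul']
  push_cast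
  rfl

theorem star_phiPlus_dotProduct_mul {d : ℕ} (a b : Fin d → ℂ) :
    star (phiPlus d) ⬝ᵥ (fun q => a q.1 * b q.2) =
      ((Real.sqrt d : ℝ) : ℂ)⁻¹ * (a ⬝ᵥ b) := by
  simp [dotProduct, phiPlus, Fintype.sum_prod_type, Finset.mul_sum, apply_ite]

/-- The bilinear Cauchy–Schwarz inequality on `ℂⁿ`. -/
theorem norm_dotProduct_sq_le {n : Type*} [Fintype n] (a b : n → ℂ) :
    ‖a ⬝ᵥ b‖ ^ 2 ≤ (∑ x, ‖a x‖ ^ 2) * ∑ x, ‖b x‖ ^ 2 := by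
  refine le_trans ?_ (Finset.sum_mul_sq_le_sq_mul_sq Finset.univ (‖a ·‖) (‖b ·‖))
  gcongr
  simpa only [dotProduct, norm_mul] using norm_sum_le Finset.univ fun x => a x * b x

/-- The overlap of a pure product state with `mesProj` is at most `1 / d`. -/
theorem re_trace_kronecker_mul_mesProj_le {d : ℕ} (a b : Fin d → ℂ)
    (ha : ∑ x, ‖a x‖ ^ 2 = 1) (hb : ∑ x, ‖b x‖ ^ 2 = 1) :
    (trace ((vecMulVec a (star a) ⊗ₖ vecMulVec b (star b)) * mesProj d)).re ≤ 1 / d := by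
  have h : (fun q : Fin d × Fin d => star a q.1 * star b q.2) =
      star (fun q : Fin d × Fin d => a q.1 * b q.2) := by
    ext q
    simp
  rw [vecMulVec_kronecker_vecMulVec_eq, h, mesProj, trace_vecMulVec_star_mul_vecMulVec_star,
    Complex.ofReal_re, star_phiPlus_dotProduct_mul, norm_mul, mul_pow, norm_inv,
    Complex.norm_real, inv_pow, Real.norm_eq_abs, sq_abs, Real.sq_sqrt d.cast_nonneg, one_div]
  refine mul_le_of_le_one_right (by positivity) ?_
  simpa only [ha, hb, mul_one] using norm_dotProduct_sq_le a b

/-- Separable states have low fidelity with the maximally entangled state: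
`Re(trace(σ * P)) ≤ 1/d`. -/
theorem re_trace_mesProj_le_of_separable (d : ℕ) (hd : 1 ≤ d)
    (σ : Matrix (Fin d × Fin d) (Fin d × Fin d) ℂ) (hσ : IsSeparable' σ) :
    (Matrix.trace (σ * mesProj d)).re ≤ 1 / d := by
  obtain ⟨I, _, p, a, b, hp, hsum, ha, hb, rfl⟩ := hσ
  simp only [Finset.sum_mul, trace_sum, smul_mul_assoc, trace_smul, smul_eq_mul, Complex.re_sum,
    Complex.re_ofReal_mul]
  calc _ ≤ ∑ i, p i * (1 / d : ℝ) := Finset.sum_le_sum fun i _ =>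
        mul_le_mul_of_nonneg_left
          (re_trace_kronecker_mul_mesProj_le (a i) (b i) (ha i) (hb i)) (hp i)
    _ = 1 / d := by rw [← Finset.sum_mul, hsum, one_mul]
end
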